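/- Assume conditions (V), (AV1) and (AV2) hold. Then the functional I = ψ + Φ satisfies the weak Palais–Smale condition at every level c₀ > 0 with respect to Y = L^∞(0,T;ℝ³): for every sequence {x_n} ⊂ X with I(x_n) → c₀ and dΦ(x_n)[z − x_n] + ψ(z) − ψ(x_n) ≥ −ε_n‖z − x_n‖ for all z ∈ X and some ε_n → 0⁺, there exist x ∈ X and a subsequence {x_{n_k}} such that x_{n_k} → x uniformly on [0,T], x is a critical point of I (i.e. dΦ(x)[z − x] + ψ(z) − ψ(x) ≥ 0 for all z ∈ X) and I(x) = c₀. -/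

import Mathlib

open Filter Topology Set MeasureTheory Function
open scoped ENNReal NNReal

noncomputable section

namespace LFE

/-- `ℝ³` with the Euclidean norm. -/
abbrev E3 : Type := EuclideanSpace ℝ (Fin 3)

def toFn (u : E3) : Fin 3 → ℝ := (WithLp.equiv 2 (Fin 3 → ℝ)) u

def fromFn (f : Fin 3 → ℝ) : E3 := (WithLp.equiv 2 (Fin 3 → ℝ)).symm f

/-- Euclidean inner product on `ℝ³`. -/
def dot (u v : E3) : ℝ := ∑ i, toFn u i * toFn v i

/-- Cross product on `ℝ³`. -/
def cross (u v : E3) : E3 :=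
  fromFn ![toFn u 1 * toFn v 2 - toFn u 2 * toFn v 1,
           toFn u 2 * toFn v 0 - toFn u 0 * toFn v 2,
           toFn u 0 * toFn v 1 - toFn u 1 * toFn v 0]

/-- Partial derivative `∂ᵢ Fⱼ` of a vector field on `ℝ³`. -/
def pd (F : E3 → E3) (x : E3) (i j : Fin 3) : ℝ :=
  toFn (fderiv ℝ F x (EuclideanSpace.single i 1)) j

/-- Curl of a vector field on `ℝ³`. -/
def curl (F : E3 → E3) (x : E3) : E3 :=
  fromFn ![pd F x 1 2 - pd F x 2 1, pd F x 2 0 - pd F x 0 2, pd F x 0 1 - pd F x 1 0]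

/-- Transpose of the Jacobian of `F` at `x`, applied to the vector `v`. -/
def jacT (F : E3 → E3) (x v : E3) : E3 :=
  fromFn fun i => dot (fderiv ℝ F x (EuclideanSpace.single i 1)) v

/-- The open set `Ω = {(t,x) : x ≠ rⱼ(t) for all j}`. -/
def Omega (N : ℕ) (r : Fin N → ℝ → E3) : Set (ℝ × E3) := {p | ∀ i, p.2 ≠ r i p.1}

/-- The basic setting: `T`-periodic `C¹` curves of singularities `r i`, moving slower than
light and never colliding, together with `C¹`, `T`-periodic (in time) potentials `V`, `A`
defined on `Ω`. -/
structure Setting (T c : ℝ) (N : ℕ) where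
  r : Fin N → ℝ → E3
  V : ℝ → E3 → ℝ
  A : ℝ → E3 → E3
  hT : 0 < T
  hc : 0 < c
  hr_per : ∀ i, Periodic (r i) T
  hr_C1 : ∀ i, ContDiff ℝ 1 (r i)
  hr_speed : ∀ i, ∃ b, b < c ∧ ∀ t, ‖deriv (r i) t‖ ≤ b
  hr_sep : ∀ i j, i ≠ j → ∀ t ∈ Icc (0:ℝ) T, r i t ≠ r j t
  hV_per : ∀ t x, V (t + T) x = V t x
  hA_per : ∀ t x, A (t + T) x = A t x
  hV_C1 : ContDiffOn ℝ 1 (fun p : ℝ × E3 => V p.1 p.2) (Omega N r)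
  hA_C1 : ContDiffOn ℝ 1 (fun p : ℝ × E3 => A p.1 p.2) (Omega N r)

variable {T c : ℝ} {N : ℕ}

/-- Condition (V): `V < 0` on `Ω` and `V` has a Keplerian blow-up at the singularities. -/
def CondV (S : Setting T c N) : Prop :=
  (∀ p ∈ Omega N S.r, S.V p.1 p.2 < 0) ∧
  ∃ κ > (0:ℝ), ∃ δ > (0:ℝ), ∀ i, ∀ p ∈ Omega N S.r,
    ‖p.2 - S.r i p.1‖ < δ → S.V p.1 p.2 ≤ -κ / ‖p.2 - S.r i p.1‖

/-- Condition (AV1): `|A| ≤ -(κ'/c) V` on `Ω` for some `κ' ∈ (0,1)`. -/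
def CondAV1 (S : Setting T c N) : Prop :=
  ∃ κ' : ℝ, 0 < κ' ∧ κ' < 1 ∧ ∀ p ∈ Omega N S.r, ‖S.A p.1 p.2‖ ≤ -(κ' / c) * S.V p.1 p.2

/-- Condition (AV2): `|V| + |∇ₓV + ∂ₜA| + |curlₓ A| → 0` as `|x| → ∞`, uniformly in `t`. -/
def CondAV2 (S : Setting T c N) : Prop :=
  ∀ ε > (0:ℝ), ∃ R : ℝ, ∀ p ∈ Omega N S.r, R < ‖p.2‖ →
    |S.V p.1 p.2| + ‖gradient (S.V p.1) p.2 + deriv (fun s => S.A s p.2) p.1‖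
      + ‖curl (S.A p.1) p.2‖ < ε

/-- `x` is a classical `T`-periodic solution of the Lorentz force equation
`d/dt (ẋ/√(1-|ẋ|²/c²)) = E(t,x) + ẋ × B(t,x)`, with
`E = -∇ₓV - ∂ₜA` and `B = curlₓ A`, avoiding the singularities. -/
def IsSolution (S : Setting T c N) (x : ℝ → E3) : Prop :=
  Periodic x T ∧ ContDiff ℝ 1 x ∧ (∀ t, (t, x t) ∈ Omega N S.r) ∧
  (∀ t, ‖deriv x t‖ < c) ∧
  ∀ t : ℝ, HasDerivAt (fun s => (Real.sqrt (1 - ‖deriv x s‖ ^ 2 / c ^ 2))⁻¹ • deriv x s)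
    (-(gradient (S.V t) (x t)) - deriv (fun s => S.A s (x t)) t
      + cross (deriv x t) (curl (S.A t) (x t))) t

/-- Membership in `X = {x ∈ W^{1,∞}(0,T;ℝ³) : x(0) = x(T)}`, identified with the space of
`T`-periodic Lipschitz paths. -/
def MemX (T : ℝ) (x : ℝ → E3) : Prop := Periodic x T ∧ ∃ K : ℝ≥0, LipschitzWith K x

/-- `‖x‖_∞` on `[0,T]`. -/
def supN (T : ℝ) (x : ℝ → E3) : ℝ := sSup ((fun t => ‖x t‖) '' Icc 0 T)

/-- `‖ẋ‖_∞` (essential supremum on `[0,T]`). -/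
def derN (T : ℝ) (x : ℝ → E3) : ℝ := (eLpNorm (deriv x) ⊤ (volume.restrict (Icc 0 T))).toReal

/-- The norm of `X`: `‖x‖ = ‖x‖_∞ + ‖ẋ‖_∞`. -/
def Xnorm (T : ℝ) (x : ℝ → E3) : ℝ := supN T x + derN T x

/-- Distance induced by the norm of `X`. -/
def Xdist (T : ℝ) (x y : ℝ → E3) : ℝ := Xnorm T (fun t => x t - y t)

/-- `D_ψ = {x ∈ X : ‖ẋ‖_∞ ≤ c}`, i.e. `x` is `c`-Lipschitz. -/
def MemDpsi (T c : ℝ) (x : ℝ → E3) : Prop := MemX T x ∧ LipschitzWith (Real.toNNReal c) x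

/-- The (finite part of the) kinetic functional `ψ`. -/
def psiVal (T c : ℝ) (x : ℝ → E3) : ℝ :=
  ∫ t in (0:ℝ)..T, c ^ 2 * (1 - Real.sqrt (1 - ‖deriv x t‖ ^ 2 / c ^ 2))

open Classical in
/-- The extended-real-valued functional `ψ`. -/
def psiE (T c : ℝ) (x : ℝ → E3) : EReal :=
  if MemDpsi T c x then (psiVal T c x : EReal) else ⊤

/-- `Λ = {x ∈ X : (t, x(t)) ∈ Ω for all t ∈ [0,T]}`. -/
def MemLambda (T : ℝ) {N : ℕ} (r : Fin N → ℝ → E3) (x : ℝ → E3) : Prop :=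
  MemX T x ∧ ∀ t ∈ Icc (0:ℝ) T, (t, x t) ∈ Omega N r

/-- The (finite part of the) potential functional `Φ`. -/
def phiVal (T : ℝ) (V : ℝ → E3 → ℝ) (A : ℝ → E3 → E3) (x : ℝ → E3) : ℝ :=
  ∫ t in (0:ℝ)..T, (-(V t (x t)) + dot (A t (x t)) (deriv x t))

open Classical in
/-- The extended-real-valued functional `Φ`. -/
def phiE (T : ℝ) {N : ℕ} (r : Fin N → ℝ → E3) (V : ℝ → E3 → ℝ) (A : ℝ → E3 → E3)
    (x : ℝ → E3) : EReal :=
  if MemLambda T r x then (phiVal T V A x : EReal) else ⊤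

/-- The action functional `I = ψ + Φ`. -/
def IE (T c : ℝ) {N : ℕ} (r : Fin N → ℝ → E3) (V : ℝ → E3 → ℝ) (A : ℝ → E3 → E3)
    (x : ℝ → E3) : EReal :=
  psiE T c x + phiE T r V A x

/-- The differential of `Φ` at `x ∈ Λ` in the direction `y`. -/
def dPhi (T : ℝ) (V : ℝ → E3 → ℝ) (A : ℝ → E3 → E3) (x y : ℝ → E3) : ℝ :=
  ∫ t in (0:ℝ)..T,
    (-(dot (gradient (V t) (x t)) (y t)) + dot (A t (x t)) (deriv y t)
      + dot (jacT (A t) (x t) (deriv x t)) (y t))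

end LFE

namespace LFE

theorem dot_eq_inner (u v : E3) : dot u v = inner ℝ u v := by
  simp [dot, toFn, PiLp.inner_apply, Fin.sum_univ_three, mul_comm]

theorem dot_gradient (f : E3 → ℝ) (x y : E3) : dot (gradient f x) y = fderiv ℝ f x y := by
  rw [dot_eq_inner, gradient, InnerProductSpace.toDual_symm_apply]

theorem eq_sum_single (y : E3) : y = ∑ i, y i • EuclideanSpace.single i (1 : ℝ) := by
  ext j
  fin_cases j <;> simp [Fin.sum_univ_three]

theorem dot_jacT (F : E3 → E3) (x v y : E3) :
    dot (jacT F x v) y = inner ℝ (fderiv ℝ F x y) v := by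
  conv_rhs => rw [eq_sum_single y]
  simp only [map_sum, map_smul, sum_inner, real_inner_smul_left]
  simp only [dot, jacT, toFn, fromFn, WithLp.equiv_apply, WithLp.equiv_symm_apply]
  refine Finset.sum_congr rfl fun i _ => ?_
  rw [mul_comm, ← dot_eq_inner]
  rfl

theorem abs_coord_le (u : E3) (i : Fin 3) : |u i| ≤ ‖u‖ := by
  simpa using PiLp.norm_apply_le u i

theorem abs_inner_fderiv_sub_le (F : E3 → E3) (x y v : E3) :
    |inner ℝ (fderiv ℝ F x y) v - inner ℝ (fderiv ℝ F x v) y|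
      ≤ 6 * ‖curl F x‖ * (‖y‖ * ‖v‖) := by
  have hexp : ∀ a b : E3, inner ℝ (fderiv ℝ F x a) b = ∑ i, ∑ j, a i * b j * pd F x i j := by
    intro a b
    conv_lhs => rw [eq_sum_single a]
    simp only [map_sum, map_smul, sum_inner, real_inner_smul_left, ← dot_eq_inner]
    refine Finset.sum_congr rfl fun i _ => ?_
    simp only [dot, pd, toFn, WithLp.equiv_apply, Finset.mul_sum]
    refine Finset.sum_congr rfl fun j _ => ?_
    ring
  have hterm : ∀ (k i j : Fin 3),
      |curl F x k * (y i * v j - y j * v i)| ≤ 2 * ‖curl F x‖ * (‖y‖ * ‖v‖) := by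
    intro k i j
    rw [abs_mul, mul_comm 2, mul_assoc]
    refine mul_le_mul (abs_coord_le _ _) ?_ (abs_nonneg _) (norm_nonneg _)
    have h1 : |y i * v j| ≤ ‖y‖ * ‖v‖ := by
      rw [abs_mul]; gcongr <;> apply abs_coord_le
    have h2 : |y j * v i| ≤ ‖y‖ * ‖v‖ := by
      rw [abs_mul]; gcongr <;> apply abs_coord_le
    have := abs_sub (y i * v j) (y j * v i)
    linarith
  have heq : inner ℝ (fderiv ℝ F x y) v - inner ℝ (fderiv ℝ F x v) y
      = curl F x 0 * (y 1 * v 2 - y 2 * v 1) + curl F x 1 * (y 2 * v 0 - y 0 * v 2)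
        + curl F x 2 * (y 0 * v 1 - y 1 * v 0) := by
    rw [hexp, hexp]
    simp [Fin.sum_univ_three, curl, fromFn]
    ring
  rw [heq]
  have h0 := hterm 0 1 2
  have h1 := hterm 1 2 0
  have h2 := hterm 2 0 1
  rw [abs_le] at *
  constructor <;> linarith [h0.1, h0.2, h1.1, h1.2, h2.1, h2.2]

theorem isOpen_Omega {N : ℕ} {r : Fin N → ℝ → E3} (hr : ∀ i, Continuous (r i)) :
    IsOpen (Omega N r) := by
  have : Omega N r = ⋂ i, {p : ℝ × E3 | p.2 ≠ r i p.1} := by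
    ext p; simp [Omega]
  rw [this]
  exact isOpen_iInter_of_finite fun i =>
    isOpen_ne_fun continuous_snd ((hr i).comp continuous_fst)

section PartialDerivatives

variable {G : Type*} [NormedAddCommGroup G] [NormedSpace ℝ G] {F : ℝ × E3 → G} {U : Set (ℝ × E3)}

theorem hasFDerivAt_of_contDiffOn (hU : IsOpen U) (hF : ContDiffOn ℝ 1 F U) {p : ℝ × E3}
    (hp : p ∈ U) : HasFDerivAt F (fderiv ℝ F p) p :=
  ((hF.contDiffAt (hU.mem_nhds hp)).differentiableAt one_ne_zero).hasFDerivAt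

theorem fderiv_snd_eq (hU : IsOpen U) (hF : ContDiffOn ℝ 1 F U) {p : ℝ × E3} (hp : p ∈ U) :
    fderiv ℝ (fun y => F (p.1, y)) p.2 = (fderiv ℝ F p).comp (ContinuousLinearMap.inr ℝ ℝ E3) := by
  have h : HasFDerivAt F (fderiv ℝ F p) (p.1, p.2) := hasFDerivAt_of_contDiffOn hU hF hp
  exact (h.comp p.2 (hasFDerivAt_prodMk_right p.1 p.2)).fderiv

theorem deriv_fst_eq (hU : IsOpen U) (hF : ContDiffOn ℝ 1 F U) {p : ℝ × E3} (hp : p ∈ U) :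
    deriv (fun s => F (s, p.2)) p.1 = fderiv ℝ F p (1, 0) := by
  have h : HasFDerivAt F (fderiv ℝ F p) (p.1, p.2) := hasFDerivAt_of_contDiffOn hU hF hp
  have := (h.comp p.1 (hasFDerivAt_prodMk_left p.1 p.2)).hasDerivAt.deriv
  simpa [Function.comp_def] using this

theorem continuousOn_fderiv_snd (hU : IsOpen U) (hF : ContDiffOn ℝ 1 F U) :
    ContinuousOn (fun p : ℝ × E3 => fderiv ℝ (fun y => F (p.1, y)) p.2) U := by
  have h : ContinuousOn (fun p => (fderiv ℝ F p).comp (ContinuousLinearMap.inr ℝ ℝ E3)) U :=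
    (hF.continuousOn_fderiv_of_isOpen hU le_rfl).clm_comp continuousOn_const
  exact h.congr fun p hp => fderiv_snd_eq hU hF hp

end PartialDerivatives

section WeakConvergence

variable {E : Type*} [NormedAddCommGroup E] [InnerProductSpace ℝ E] {T : ℝ}

theorem intervalIntegrable_inner (hT : 0 ≤ T) {g w : ℝ → E} {C : ℝ}
    (hg : ContinuousOn g (Icc 0 T)) (hw : StronglyMeasurable w)
    (hC : ∀ t ∈ Icc 0 T, ‖w t‖ ≤ C) :
    IntervalIntegrable (fun t => inner ℝ (g t) (w t)) volume 0 T := by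
  rw [intervalIntegrable_iff_integrableOn_Icc_of_le hT]
  obtain ⟨M, hM⟩ := isCompact_Icc.exists_bound_of_continuousOn hg
  refine Integrable.of_bound (C := M * C) ?_ ?_
  · exact AEStronglyMeasurable.inner (𝕜 := ℝ)
      (hg.aestronglyMeasurable_of_isCompact isCompact_Icc measurableSet_Icc)
      hw.aestronglyMeasurable
  · filter_upwards [ae_restrict_mem measurableSet_Icc] with t ht
    exact (norm_inner_le_norm _ _).trans
      (mul_le_mul (hM t ht) (hC t ht) (norm_nonneg _) ((norm_nonneg _).trans (hM t ht)))

theorem tendsto_integral_inner_sub (hT : 0 ≤ T) {g : ℕ → ℝ → E} {g₀ : ℝ → E} {w : ℕ → ℝ → E}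
    {C : ℝ} (hg : TendstoUniformlyOn g g₀ atTop (Icc 0 T))
    (hC : ∀ n, ∀ t ∈ Icc 0 T, ‖w n t‖ ≤ C) :
    Tendsto (fun n => ∫ t in (0:ℝ)..T, inner ℝ (g n t - g₀ t) (w n t)) atTop (𝓝 0) := by
  have hC0 : 0 ≤ C := (norm_nonneg _).trans (hC 0 0 ⟨le_rfl, hT⟩)
  rw [Metric.tendsto_nhds]
  intro ε hε
  have hη : 0 < ε / (C * T + 1) := by positivity
  filter_upwards [Metric.tendstoUniformlyOn_iff.1 hg _ hη] with n hn
  rw [dist_zero_right]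
  have hb : ‖∫ t in (0:ℝ)..T, inner ℝ (g n t - g₀ t) (w n t)‖
      ≤ (ε / (C * T + 1) * C) * |T - 0| := by
    refine intervalIntegral.norm_integral_le_of_norm_le_const fun t ht => ?_
    rw [uIoc_of_le hT] at ht
    have ht' : t ∈ Icc 0 T := ⟨ht.1.le, ht.2⟩
    refine (norm_inner_le_norm _ _).trans
      (mul_le_mul ?_ (hC n t ht') (norm_nonneg _) hη.le)
    rw [← dist_eq_norm, dist_comm]
    exact (hn t ht').le
  refine hb.trans_lt ?_
  rw [sub_zero, abs_of_nonneg hT, div_mul_eq_mul_div, div_mul_eq_mul_div,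
    div_lt_iff₀ (by positivity)]
  nlinarith

theorem tendsto_integral_mul_deriv (hT : 0 ≤ T) {f : ℕ → ℝ → ℝ} {K : ℝ≥0}
    (hf : ∀ n, LipschitzWith K (f n))
    (h0 : TendstoUniformlyOn f (fun _ => 0) atTop (Icc 0 T))
    {p : ℝ → ℝ} (hp : ContinuousOn p (Icc 0 T)) :
    Tendsto (fun n => ∫ t in (0:ℝ)..T, p t * deriv (f n) t) atTop (𝓝 0) := by
  have hpt : ∀ t ∈ Icc 0 T, Tendsto (fun n => f n t) atTop (𝓝 0) := fun t ht =>
    h0.tendsto_at ht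
  have hint : ∀ (q : ℝ → ℝ) (n : ℕ), ContinuousOn q (Icc 0 T) →
      IntervalIntegrable (fun t => q t * deriv (f n) t) volume 0 T := by
    intro q n hq
    have := intervalIntegrable_inner hT hq (stronglyMeasurable_deriv (f n))
      (fun t _ => norm_deriv_le_of_lipschitz (hf n))
    simpa [mul_comm] using this
  have hpoly : ∀ q : Polynomial ℝ,
      Tendsto (fun n => ∫ t in (0:ℝ)..T, q.eval t * deriv (f n) t) atTop (𝓝 0) := by
    intro q
    have hq : ContDiff ℝ 1 (fun t => q.eval t) := by
      simpa [Polynomial.coe_aeval_eq_eval] using q.contDiff_aeval (𝕜 := ℝ) 1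
    obtain ⟨L, hL⟩ := (hq.locallyLipschitz.locallyLipschitzOn
      (s := uIcc 0 T)).exists_lipschitzOnWith_of_compact isCompact_uIcc
    have hparts : ∀ n, ∫ t in (0:ℝ)..T, q.eval t * deriv (f n) t
        = q.eval T * f n T - q.eval 0 * f n 0
          - ∫ t in (0:ℝ)..T, deriv (fun t => q.eval t) t * f n t := fun n =>
      hL.absolutelyContinuousOnInterval.integral_mul_deriv_eq_deriv_mul
        ((hf n).lipschitzOnWith (s := uIcc 0 T)).absolutelyContinuousOnInterval
    simp_rw [hparts]
    obtain ⟨C, hC⟩ := (isCompact_Icc (a := (0:ℝ)) (b := T)).exists_bound_of_continuousOn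
      (hq.continuous_deriv le_rfl).continuousOn
    have h1 := tendsto_integral_inner_sub hT h0 (w := fun _ => deriv fun t => q.eval t)
      (fun _ => hC)
    have h2 := ((((hpt T ⟨hT, le_rfl⟩).const_mul (q.eval T)).sub
      ((hpt 0 ⟨le_rfl, hT⟩).const_mul (q.eval 0))).sub h1)
    simpa using h2
  rw [Metric.tendsto_nhds]
  intro ε hε
  obtain ⟨q, hq⟩ := exists_polynomial_near_of_continuousOn 0 T p hp (ε / 2 / (K * T + 1))
    (by positivity)
  filter_upwards [Metric.tendsto_nhds.1 (hpoly q) (ε / 2) (by positivity)] with n hn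
  rw [dist_zero_right] at hn ⊢
  have hsplit : ∫ t in (0:ℝ)..T, p t * deriv (f n) t
      = (∫ t in (0:ℝ)..T, (p t - q.eval t) * deriv (f n) t)
        + ∫ t in (0:ℝ)..T, q.eval t * deriv (f n) t := by
    rw [← intervalIntegral.integral_add (hint (fun t => p t - q.eval t) n
      (hp.sub q.continuous.continuousOn))
      (hint _ n q.continuous.continuousOn)]
    refine intervalIntegral.integral_congr fun t _ => ?_
    ring
  have hb : ‖∫ t in (0:ℝ)..T, (p t - q.eval t) * deriv (f n) t‖
      ≤ (ε / 2 / (K * T + 1) * K) * |T - 0| := by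
    refine intervalIntegral.norm_integral_le_of_norm_le_const fun t ht => ?_
    rw [uIoc_of_le hT] at ht
    rw [norm_mul]
    refine mul_le_mul ?_ (norm_deriv_le_of_lipschitz (hf n)) (norm_nonneg _) (by positivity)
    rw [Real.norm_eq_abs, abs_sub_comm]
    exact (hq t ⟨ht.1.le, ht.2⟩).le
  have hb' : (ε / 2 / (K * T + 1) * K) * |T - 0| < ε / 2 := by
    have : (0:ℝ) ≤ K := K.2
    rw [sub_zero, abs_of_nonneg hT, div_mul_eq_mul_div, div_mul_eq_mul_div,
      div_lt_iff₀ (by positivity)]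
    nlinarith
  rw [hsplit]
  exact (norm_add_le _ _).trans_lt (by linarith)

theorem hasDerivAt_coord {u : ℝ → E3} {u' : E3} {t : ℝ} (h : HasDerivAt u u' t) (i : Fin 3) :
    HasDerivAt (fun s => u s i) (u' i) t := by
  have := ((EuclideanSpace.proj i : E3 →L[ℝ] ℝ).hasFDerivAt
    (x := u t)).comp_hasDerivAt t h
  exact this

theorem tendsto_integral_inner_deriv_sub (hT : 0 ≤ T) {u : ℕ → ℝ → E3} {u₀ : ℝ → E3} {K : ℝ≥0}
    (hu : ∀ n, LipschitzWith K (u n)) (hu₀ : LipschitzWith K u₀)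
    (hlim : TendstoUniformlyOn u u₀ atTop (Icc 0 T))
    {g : ℝ → E3} (hg : ContinuousOn g (Icc 0 T)) :
    Tendsto (fun n => ∫ t in (0:ℝ)..T, inner ℝ (g t) (deriv (u n) t - deriv u₀ t))
      atTop (𝓝 0) := by
  have hlip : ∀ n i, LipschitzWith (K + K) (fun t => u n t i - u₀ t i) := by
    intro n i
    refine LipschitzWith.of_dist_le_mul fun s t => ?_
    have h := ((hu n).sub hu₀).dist_le_mul s t
    refine le_trans ?_ h
    rw [Real.dist_eq, dist_eq_norm]
    exact abs_coord_le (u n s - u₀ s - (u n t - u₀ t)) i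
  have hunif : ∀ i, TendstoUniformlyOn (fun n t => u n t i - u₀ t i) (fun _ => 0) atTop
      (Icc 0 T) := by
    intro i
    rw [Metric.tendstoUniformlyOn_iff] at hlim ⊢
    intro η hη
    filter_upwards [hlim η hη] with n hn t ht
    refine lt_of_le_of_lt ?_ (hn t ht)
    rw [dist_comm, dist_zero_right, dist_comm, dist_eq_norm]
    exact abs_coord_le (u n t - u₀ t) i
  have hgi : ∀ i : Fin 3, ContinuousOn (fun t => g t i) (Icc 0 T) := fun i =>
    (EuclideanSpace.proj i : E3 →L[ℝ] ℝ).continuous.comp_continuousOn hg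
  have hint : ∀ n i, IntervalIntegrable
      (fun t => g t i * deriv (fun t => u n t i - u₀ t i) t) volume 0 T := by
    intro n i
    have := intervalIntegrable_inner hT (hgi i)
      (stronglyMeasurable_deriv (fun t => u n t i - u₀ t i))
      (fun t _ => norm_deriv_le_of_lipschitz (hlip n i))
    simpa [mul_comm] using this
  have heq : ∀ n, ∫ t in (0:ℝ)..T, inner ℝ (g t) (deriv (u n) t - deriv u₀ t)
      = ∑ i, ∫ t in (0:ℝ)..T, g t i * deriv (fun t => u n t i - u₀ t i) t := by
    intro n
    rw [← intervalIntegral.integral_finsetSum fun i _ => hint n i]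
    refine intervalIntegral.integral_congr_ae ?_
    filter_upwards [(hu n).ae_differentiableAt_real, hu₀.ae_differentiableAt_real]
      with t h1 h2 _
    have h3 := h1.hasDerivAt.sub h2.hasDerivAt
    have h4 : ∀ i, deriv (fun t => u n t i - u₀ t i) t = (deriv (u n) t - deriv u₀ t) i :=
      fun i => (hasDerivAt_coord h3 i).deriv
    simp_rw [h4, ← dot_eq_inner]
    rfl
  simp_rw [heq]
  have := tendsto_finsetSum (Finset.univ : Finset (Fin 3)) fun i _ =>
    tendsto_integral_mul_deriv hT (fun n => hlip n i) (hunif i) (hgi i)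
  simpa using this

theorem tendsto_integral_inner_deriv (hT : 0 ≤ T) {u : ℕ → ℝ → E3} {u₀ : ℝ → E3} {K : ℝ≥0}
    (hu : ∀ n, LipschitzWith K (u n)) (hu₀ : LipschitzWith K u₀)
    (hlim : TendstoUniformlyOn u u₀ atTop (Icc 0 T))
    {g : ℕ → ℝ → E3} {g₀ : ℝ → E3} (hg : ∀ n, ContinuousOn (g n) (Icc 0 T))
    (hg₀ : ContinuousOn g₀ (Icc 0 T)) (hgl : TendstoUniformlyOn g g₀ atTop (Icc 0 T)) :
    Tendsto (fun n => ∫ t in (0:ℝ)..T, inner ℝ (g n t) (deriv (u n) t)) atTop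
      (𝓝 (∫ t in (0:ℝ)..T, inner ℝ (g₀ t) (deriv u₀ t))) := by
  have hK : ∀ n, ∀ t ∈ Icc 0 T, ‖deriv (u n) t‖ ≤ K := fun n t _ =>
    norm_deriv_le_of_lipschitz (hu n)
  have hK₀ : ∀ t ∈ Icc 0 T, ‖deriv u₀ t‖ ≤ K := fun t _ => norm_deriv_le_of_lipschitz hu₀
  have hsum := (tendsto_integral_inner_sub hT hgl hK).add
    (tendsto_integral_inner_deriv_sub hT hu hu₀ hlim hg₀)
  rw [add_zero] at hsum
  have hfin := hsum.add_const (∫ t in (0:ℝ)..T, inner ℝ (g₀ t) (deriv u₀ t))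
  rw [zero_add] at hfin
  refine hfin.congr fun n => ?_
  have i1 := intervalIntegrable_inner (g := fun t => g n t - g₀ t) hT ((hg n).sub hg₀)
     (stronglyMeasurable_deriv (u n)) (hK n)
  have i2 := intervalIntegrable_inner hT hg₀ (stronglyMeasurable_deriv (u n)) (hK n)
  have i3 := intervalIntegrable_inner hT hg₀ (stronglyMeasurable_deriv u₀) hK₀
  simp only [inner_sub_right]
  rw [intervalIntegral.integral_sub i2 i3, add_assoc, sub_add_cancel,
    ← intervalIntegral.integral_add i1 i2]
  refine intervalIntegral.integral_congr fun t _ => ?_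
  simp [inner_sub_left]

end WeakConvergence

theorem integral_deriv_of_lipschitzWith {u : ℝ → E3} {K : ℝ≥0} (hu : LipschitzWith K u)
    (a b : ℝ) : ∫ t in a..b, deriv u t = u b - u a := by
  have hint : IntervalIntegrable (deriv u) volume a b :=
    (intervalIntegrable_const (c := (K : ℝ))).mono_fun
      (stronglyMeasurable_deriv u).aestronglyMeasurable (.of_forall fun t =>
        (norm_deriv_le_of_lipschitz hu).trans (le_abs_self _))
  ext i
  have hlip : LipschitzWith K (fun t => u t i) := LipschitzWith.of_dist_le_mul fun s t => by
    refine le_trans ?_ (hu.dist_le_mul s t)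
    rw [Real.dist_eq, dist_eq_norm]
    exact abs_coord_le (u s - u t) i
  have hcomm := (EuclideanSpace.proj i : E3 →L[ℝ] ℝ).intervalIntegral_comp_comm hint
  have hcoord : ∫ t in a..b, (deriv u t) i = ∫ t in a..b, deriv (fun t => u t i) t := by
    refine intervalIntegral.integral_congr_ae ?_
    filter_upwards [hu.ae_differentiableAt_real] with t ht _
    exact (hasDerivAt_coord ht.hasDerivAt i).deriv.symm
  have hftc := (hlip.lipschitzOnWith (s := uIcc a b)).absolutelyContinuousOnInterval
    |>.integral_deriv_eq_sub
  exact hcomm.symm.trans (hcoord.trans hftc)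

/-- The relativistic kinetic energy density. -/
def kinetic (c : ℝ) (v : E3) : ℝ := c ^ 2 * (1 - Real.sqrt (1 - ‖v‖ ^ 2 / c ^ 2))

theorem continuous_kinetic (c : ℝ) : Continuous (kinetic c) := by
  unfold kinetic; fun_prop

theorem kinetic_nonneg (c : ℝ) (v : E3) : 0 ≤ kinetic c v := by
  refine mul_nonneg (sq_nonneg _) (sub_nonneg.2 (Real.sqrt_le_one.2 ?_))
  have : 0 ≤ ‖v‖ ^ 2 / c ^ 2 := by positivity
  linarith

theorem norm_kinetic_le (c : ℝ) (v : E3) : ‖kinetic c v‖ ≤ c ^ 2 := by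
  rw [Real.norm_of_nonneg (kinetic_nonneg c v)]
  exact mul_le_of_le_one_right (sq_nonneg c) (by linarith [Real.sqrt_nonneg (1 - ‖v‖ ^ 2 / c ^ 2)])

theorem convexOn_kinetic {c : ℝ} (hc : 0 < c) :
    ConvexOn ℝ (Metric.closedBall (0 : E3) c) (kinetic c) := by
  refine ⟨convex_closedBall _ _, fun x hx y hy a b ha hb hab => ?_⟩
  rw [mem_closedBall_zero_iff] at hx hy
  have hnn : ∀ v : E3, ‖v‖ ≤ c → 0 ≤ 1 - ‖v‖ ^ 2 / c ^ 2 := fun v hv => by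
    rw [sub_nonneg, div_le_one (by positivity)]
    gcongr
  have hα := Real.sq_sqrt (hnn x hx)
  have hβ := Real.sq_sqrt (hnn y hy)
  set α := Real.sqrt (1 - ‖x‖ ^ 2 / c ^ 2)
  set β := Real.sqrt (1 - ‖y‖ ^ 2 / c ^ 2)
  have hnorm : ‖a • x + b • y‖ ≤ a * ‖x‖ + b * ‖y‖ := by
    refine (norm_add_le _ _).trans_eq ?_
    rw [norm_smul, norm_smul, Real.norm_of_nonneg ha, Real.norm_of_nonneg hb]
  have hsq : ‖a • x + b • y‖ ^ 2 ≤ a * ‖x‖ ^ 2 + b * ‖y‖ ^ 2 := by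
    have h1 : ‖a • x + b • y‖ ^ 2 ≤ (a * ‖x‖ + b * ‖y‖) ^ 2 := by gcongr
    have h2 : a = 1 - b := by linarith
    subst h2
    nlinarith [mul_nonneg (mul_nonneg ha hb) (sq_nonneg (‖x‖ - ‖y‖))]
  have hroot : a * α + b * β ≤ Real.sqrt (1 - ‖a • x + b • y‖ ^ 2 / c ^ 2) := by
    refine Real.le_sqrt_of_sq_le ?_
    have h1 : (a * α + b * β) ^ 2 ≤ a * α ^ 2 + b * β ^ 2 := by
      have h2 : a = 1 - b := by linarith
      subst h2
      nlinarith [mul_nonneg (mul_nonneg ha hb) (sq_nonneg (α - β))]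
    have h2 : ‖a • x + b • y‖ ^ 2 / c ^ 2 ≤ a * (‖x‖ ^ 2 / c ^ 2) + b * (‖y‖ ^ 2 / c ^ 2) := by
      rw [← mul_div_assoc, ← mul_div_assoc, ← add_div]
      gcongr
    rw [hα, hβ] at h1
    nlinarith
  simp only [kinetic, smul_eq_mul]
  have hc2 : 0 ≤ c ^ 2 := sq_nonneg c
  have : c ^ 2 * (a * α + b * β) ≤ c ^ 2 * Real.sqrt (1 - ‖a • x + b • y‖ ^ 2 / c ^ 2) := by
    gcongr
  have : c ^ 2 * (a + b) = c ^ 2 := by rw [hab, mul_one]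
  linarith

theorem intervalIntegrable_kinetic (c : ℝ) {u : ℝ → E3} (hu : StronglyMeasurable u) (a b : ℝ) :
    IntervalIntegrable (fun t => kinetic c (u t)) volume a b :=
  (intervalIntegrable_const (c := c ^ 2)).mono_fun
    ((continuous_kinetic c).comp_stronglyMeasurable hu).aestronglyMeasurable
    (.of_forall fun _ => (norm_kinetic_le c _).trans (le_abs_self _))

/-- Jensen's inequality for the kinetic energy density along a path. -/
theorem kinetic_slope_le {c : ℝ} (hc : 0 < c) {u : ℝ → E3}
    (hu : LipschitzWith (Real.toNNReal c) u) {h : ℝ} (hh : 0 < h) (t : ℝ) :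
    kinetic c (h⁻¹ • (u (t + h) - u t)) ≤ h⁻¹ * ∫ s in (0:ℝ)..h, kinetic c (deriv u (t + s)) := by
  have hmeas : StronglyMeasurable (fun s => deriv u (t + s)) :=
    (stronglyMeasurable_deriv u).comp_measurable (measurable_const_add t)
  have hbd : ∀ s, ‖deriv u (t + s)‖ ≤ c := fun s => by
    simpa [hc.le] using norm_deriv_le_of_lipschitz (x₀ := t + s) hu
  have hint : IntervalIntegrable (fun s => deriv u (t + s)) volume 0 h :=
    (intervalIntegrable_const (c := c)).mono_fun hmeas.aestronglyMeasurable
      (.of_forall fun s => (hbd s).trans (le_abs_self _))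
  have hne : NeZero (volume.restrict (uIoc 0 h)) := by
    refine ⟨fun h0 => ?_⟩
    have := congrArg (fun μ : Measure ℝ => μ univ) h0
    simp [uIoc_of_le hh.le] at this
    linarith
  have hfin : IsFiniteMeasure (volume.restrict (uIoc 0 h)) := by
    rw [uIoc_of_le hh.le]; infer_instance
  have hJ := (convexOn_kinetic hc).map_average_le (continuous_kinetic c).continuousOn
    Metric.isClosed_closedBall (μ := volume.restrict (uIoc 0 h)) (f := fun s => deriv u (t + s))
    (.of_forall fun s => by simpa using hbd s) (intervalIntegrable_iff.1 hint)
    (intervalIntegrable_iff.1 (intervalIntegrable_kinetic c hmeas 0 h))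
  rw [interval_average_eq, interval_average_eq, sub_zero] at hJ
  have hshift : ∫ s in (0:ℝ)..h, deriv u (t + s) = u (t + h) - u t := by
    rw [intervalIntegral.integral_comp_add_left (fun s => deriv u s), add_zero,
      integral_deriv_of_lipschitzWith hu]
  rw [hshift] at hJ
  simpa using hJ

theorem _root_.Function.Periodic.deriv {E : Type*} [NormedAddCommGroup E] [NormedSpace ℝ E]
    {u : ℝ → E} {T : ℝ} (hu : Periodic u T) : Periodic (deriv u) T := fun t => by
  rw [← deriv_comp_add_const]
  congr 1
  exact funext hu

theorem integral_kinetic_slope_le {c T : ℝ} (hc : 0 < c) (hT : 0 ≤ T) {u : ℝ → E3}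
    (hper : Periodic u T) (hu : LipschitzWith (Real.toNNReal c) u) {h : ℝ} (hh : 0 < h) :
    ∫ t in (0:ℝ)..T, kinetic c (h⁻¹ • (u (t + h) - u t)) ≤ psiVal T c u := by
  have hmeas : StronglyMeasurable fun p : ℝ × ℝ => kinetic c (deriv u (p.1 + p.2)) :=
    (continuous_kinetic c).comp_stronglyMeasurable
      ((stronglyMeasurable_deriv u).comp_measurable measurable_add)
  have hprod : Integrable (uncurry fun t s => kinetic c (deriv u (t + s)))
      ((volume.restrict (uIoc 0 T)).prod (volume.restrict (Ioc 0 h))) := by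
    have : IsFiniteMeasure (volume.restrict (uIoc 0 T)) := by
      rw [uIoc_of_le hT]; infer_instance
    exact Integrable.of_bound hmeas.aestronglyMeasurable (c ^ 2)
      (.of_forall fun p => norm_kinetic_le c _)
  have hswap : ∫ t in (0:ℝ)..T, ∫ s in (0:ℝ)..h, kinetic c (deriv u (t + s))
      = h * psiVal T c u := by
    simp_rw [intervalIntegral.integral_of_le hh.le]
    rw [intervalIntegral_integral_swap hprod]
    have : ∀ s, ∫ t in (0:ℝ)..T, kinetic c (deriv u (t + s)) = psiVal T c u := by
      intro s
      rw [intervalIntegral.integral_comp_add_right (fun t => kinetic c (deriv u t)), zero_add,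
        add_comm T s]
      have hp : Periodic (fun t => kinetic c (deriv u t)) T := fun t => by
        simp only [hper.deriv t]
      rw [hp.intervalIntegral_add_eq s 0, zero_add]
      rfl
    simp_rw [this]
    simp [hh.le]
  have hle : ∫ t in (0:ℝ)..T, kinetic c (h⁻¹ • (u (t + h) - u t))
      ≤ ∫ t in (0:ℝ)..T, h⁻¹ * ∫ s in (0:ℝ)..h, kinetic c (deriv u (t + s)) := by
    refine intervalIntegral.integral_mono_on hT ?_ ?_ fun t _ => kinetic_slope_le hc hu hh t
    · refine Continuous.intervalIntegrable ((continuous_kinetic c).comp ?_) _ _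
      have := hu.continuous
      fun_prop
    · refine IntervalIntegrable.const_mul ?_ _
      have := hprod.integral_prod_left
      rw [intervalIntegrable_iff]
      simp_rw [intervalIntegral.integral_of_le hh.le]
      exact this
  rw [intervalIntegral.integral_const_mul, hswap, inv_mul_cancel_left₀ hh.ne'] at hle
  exact hle

theorem tendsto_integral_kinetic_slope {c T : ℝ} {u : ℝ → E3} {K : ℝ≥0}
    (hu : LipschitzWith K u) :
    Tendsto (fun h => ∫ t in (0:ℝ)..T, kinetic c (h⁻¹ • (u (t + h) - u t))) (𝓝[>] 0)
      (𝓝 (psiVal T c u)) := by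
  refine intervalIntegral.tendsto_integral_filter_of_dominated_convergence (fun _ => c ^ 2)
    (.of_forall fun h => ?_) (.of_forall fun h => .of_forall fun t _ => norm_kinetic_le c _)
    intervalIntegrable_const ?_
  · refine (Continuous.comp (continuous_kinetic c) ?_).aestronglyMeasurable
    have := hu.continuous
    fun_prop
  · filter_upwards [hu.ae_differentiableAt_real] with t ht _
    exact ((continuous_kinetic c).tendsto _).comp
      (ht.hasDerivAt.tendsto_slope_zero_right)

/-- Lower semicontinuity of `ψ` under pointwise convergence. -/
theorem eventually_lt_psiVal {c T : ℝ} (hc : 0 < c) (hT : 0 ≤ T) {u : ℕ → ℝ → E3} {u₀ : ℝ → E3}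
    (hper : ∀ n, Periodic (u n) T) (hu : ∀ n, LipschitzWith (Real.toNNReal c) (u n))
    (hu₀ : LipschitzWith (Real.toNNReal c) u₀)
    (hlim : ∀ t, Tendsto (fun n => u n t) atTop (𝓝 (u₀ t))) {a : ℝ} (ha : a < psiVal T c u₀) :
    ∀ᶠ n in atTop, a < psiVal T c (u n) := by
  obtain ⟨h, hah, hh⟩ := (((tendsto_integral_kinetic_slope (c := c) (T := T) hu₀).eventually
    (lt_mem_nhds ha)).and self_mem_nhdsWithin).exists
  have hlim' : Tendsto (fun n => ∫ t in (0:ℝ)..T, kinetic c (h⁻¹ • (u n (t + h) - u n t))) atTop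
      (𝓝 (∫ t in (0:ℝ)..T, kinetic c (h⁻¹ • (u₀ (t + h) - u₀ t)))) := by
    refine intervalIntegral.tendsto_integral_filter_of_dominated_convergence (fun _ => c ^ 2)
      (.of_forall fun n => ?_) (.of_forall fun n => .of_forall fun t _ => norm_kinetic_le c _)
      intervalIntegrable_const (.of_forall fun t _ => ?_)
    · refine (Continuous.comp (continuous_kinetic c) ?_).aestronglyMeasurable
      have := (hu n).continuous
      fun_prop
    · exact ((continuous_kinetic c).tendsto _).comp
        (((hlim (t + h)).sub (hlim t)).const_smul h⁻¹)
  filter_upwards [hlim'.eventually (lt_mem_nhds hah)] with n hn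
  exact hn.trans_le (integral_kinetic_slope_le hc hT (hper n) (hu n) hh)

section Paths

variable {T : ℝ}

theorem tendstoUniformlyOn_comp_path {G : Type*} [UniformSpace G] {U : Set (ℝ × E3)}
    (hU : IsOpen U) {H : ℝ × E3 → G} (hH : ContinuousOn H U) {u : ℕ → ℝ → E3} {u₀ : ℝ → E3}
    (hu₀ : Continuous u₀) (hmem : ∀ t ∈ Icc 0 T, (t, u₀ t) ∈ U)
    (hlim : TendstoUniformlyOn u u₀ atTop (Icc 0 T)) :
    TendstoUniformlyOn (fun n t => H (t, u n t)) (fun t => H (t, u₀ t)) atTop (Icc 0 T) := by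
  rw [← tendstoLocallyUniformlyOn_iff_tendstoUniformlyOn_of_compact isCompact_Icc,
    tendstoLocallyUniformlyOn_iff_forall_tendsto]
  intro t ht
  have hcont : ContinuousAt H (t, u₀ t) := hH.continuousAt (hU.mem_nhds (hmem t ht))
  have hsnd : Tendsto (fun y : ℕ × ℝ => y.2) (atTop ×ˢ 𝓝[Icc 0 T] t) (𝓝 t) :=
    tendsto_snd.mono_right nhdsWithin_le_nhds
  have h0 : Tendsto (fun y : ℕ × ℝ => u₀ y.2) (atTop ×ˢ 𝓝[Icc 0 T] t) (𝓝 (u₀ t)) :=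
    (hu₀.tendsto t).comp hsnd
  have hloc := tendstoLocallyUniformlyOn_iff_forall_tendsto.1 hlim.tendstoLocallyUniformlyOn t ht
  have h1 : Tendsto (fun y : ℕ × ℝ => u y.1 y.2) (atTop ×ˢ 𝓝[Icc 0 T] t) (𝓝 (u₀ t)) := by
    exact h0.congr_uniformity hloc
  have h2 := hcont.tendsto.comp (hsnd.prodMk_nhds h0)
  have h3 := hcont.tendsto.comp (hsnd.prodMk_nhds h1)
  exact (h2.prodMk_nhds h3).mono_right (nhds_prod_eq.le.trans (by
    rw [← nhds_prod_eq]; exact nhds_le_uniformity _))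

theorem continuousOn_comp_path {G : Type*} [TopologicalSpace G] {U : Set (ℝ × E3)}
    {H : ℝ × E3 → G} (hH : ContinuousOn H U) {u : ℝ → E3} (hu : Continuous u)
    (hmem : ∀ t ∈ Icc 0 T, (t, u t) ∈ U) : ContinuousOn (fun t => H (t, u t)) (Icc 0 T) :=
  hH.comp (continuous_id.prodMk hu).continuousOn hmem

theorem exists_lipschitzOnWith_comp_path {G : Type*} [NormedAddCommGroup G] [NormedSpace ℝ G]
    {U : Set (ℝ × E3)} (hU : IsOpen U) {H : ℝ × E3 → G} (hH : ContDiffOn ℝ 1 H U) {u : ℝ → E3}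
    {K : ℝ≥0} (hu : LipschitzWith K u) (hmem : ∀ t ∈ Icc 0 T, (t, u t) ∈ U) :
    ∃ L, LipschitzOnWith L (fun t => H (t, u t)) (Icc 0 T) := by
  refine LocallyLipschitzOn.exists_lipschitzOnWith_of_compact isCompact_Icc fun t ht => ?_
  obtain ⟨L, s, hs, hL⟩ :=
    (hH.contDiffAt (hU.mem_nhds (hmem t ht))).exists_lipschitzOnWith
  have hγ : LipschitzWith (max 1 K) fun t => (t, u t) := LipschitzWith.id.prodMk hu
  refine ⟨L * max 1 K, (fun t => (t, u t)) ⁻¹' s,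
    mem_nhdsWithin_of_mem_nhds (hγ.continuous.continuousAt.preimage_mem_nhds hs), ?_⟩
  exact hL.comp hγ.lipschitzOnWith (mapsTo_preimage _ _)

theorem tendsto_integral_inner_const (hT : 0 ≤ T) {E : Type*} [NormedAddCommGroup E]
    [InnerProductSpace ℝ E] {g : ℕ → ℝ → E} {g₀ : ℝ → E}
    (hg : ∀ n, ContinuousOn (g n) (Icc 0 T)) (hg₀ : ContinuousOn g₀ (Icc 0 T))
    (hgl : TendstoUniformlyOn g g₀ atTop (Icc 0 T)) {w : ℝ → E} (hw : StronglyMeasurable w)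
    {C : ℝ} (hC : ∀ t ∈ Icc 0 T, ‖w t‖ ≤ C) :
    Tendsto (fun n => ∫ t in (0:ℝ)..T, inner ℝ (g n t) (w t)) atTop
      (𝓝 (∫ t in (0:ℝ)..T, inner ℝ (g₀ t) (w t))) := by
  have h := (tendsto_integral_inner_sub hT hgl (w := fun _ => w) fun _ => hC).add_const
    (∫ t in (0:ℝ)..T, inner ℝ (g₀ t) (w t))
  rw [zero_add] at h
  refine h.congr fun n => ?_
  rw [← intervalIntegral.integral_add
    (intervalIntegrable_inner (g := fun t => g n t - g₀ t) hT ((hg n).sub hg₀) hw hC)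
    (intervalIntegrable_inner hT hg₀ hw hC)]
  refine intervalIntegral.integral_congr fun t _ => ?_
  simp [inner_sub_left]

theorem tendsto_integral_of_tendstoUniformlyOn (hT : 0 ≤ T) {g : ℕ → ℝ → ℝ} {g₀ : ℝ → ℝ}
    (hg : ∀ n, ContinuousOn (g n) (Icc 0 T)) (hg₀ : ContinuousOn g₀ (Icc 0 T))
    (hgl : TendstoUniformlyOn g g₀ atTop (Icc 0 T)) :
    Tendsto (fun n => ∫ t in (0:ℝ)..T, g n t) atTop (𝓝 (∫ t in (0:ℝ)..T, g₀ t)) := by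
  have := tendsto_integral_inner_const hT hg hg₀ hgl (w := fun _ => (1:ℝ))
    stronglyMeasurable_const (C := 1) (by simp)
  simpa using this

theorem Xdist_le (hT : 0 ≤ T) {z u : ℝ → E3} {K : ℝ≥0}
    (h : LipschitzWith K fun t => z t - u t) :
    Xdist T z u ≤ ‖z 0 - u 0‖ + K * T + K := by
  refine add_le_add (csSup_le ⟨_, 0, ⟨le_rfl, hT⟩, rfl⟩ ?_) ?_
  · rintro _ ⟨t, ht, rfl⟩
    have h1 : ‖(z t - u t) - (z 0 - u 0)‖ ≤ K * T := by
      have := h.dist_le_mul t 0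
      rw [dist_eq_norm] at this
      refine this.trans ?_
      rw [Real.dist_eq, sub_zero, abs_of_nonneg ht.1]
      gcongr
      exact ht.2
    have h2 := norm_le_insert' (z t - u t) (z 0 - u 0)
    simp only
    linarith
  · refine ENNReal.toReal_le_of_le_ofReal K.2 ?_
    rw [eLpNorm_exponent_top]
    refine eLpNormEssSup_le_of_ae_bound (.of_forall fun t => norm_deriv_le_of_lipschitz h)

end Paths

section Action

variable {T c : ℝ} {N : ℕ} (S : Setting T c N)

theorem Setting.isOpen_Omega : IsOpen (Omega N S.r) :=
  LFE.isOpen_Omega fun i => (S.hr_C1 i).continuous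

theorem Setting.continuousOn_fderiv_V :
    ContinuousOn (fun p : ℝ × E3 => fderiv ℝ (S.V p.1) p.2) (Omega N S.r) :=
  continuousOn_fderiv_snd S.isOpen_Omega S.hV_C1

theorem Setting.continuousOn_fderiv_A :
    ContinuousOn (fun p : ℝ × E3 => fderiv ℝ (S.A p.1) p.2) (Omega N S.r) :=
  continuousOn_fderiv_snd S.isOpen_Omega S.hA_C1

variable {S}

theorem MemLambda.mem_Omega {u : ℝ → E3} (hu : MemLambda T S.r u) (t : ℝ) :
    (t, u t) ∈ Omega N S.r := by
  have hper : Periodic (fun t => (u t, fun i => S.r i t)) T := fun t => by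
    simp only [hu.1.1 t, S.hr_per _ t]
  obtain ⟨s, hs, hst⟩ := hper.exists_mem_Ico₀ S.hT t
  intro i
  have h1 := congrArg Prod.fst hst
  have h2 := congrFun (congrArg Prod.snd hst) i
  simp only at h1 h2 ⊢
  rw [h1, h2]
  exact hu.2 s ⟨hs.1, hs.2.le⟩ i

theorem MemDpsi.norm_deriv_le (hc : 0 < c) {u : ℝ → E3} (hu : MemDpsi T c u) (t : ℝ) :
    ‖deriv u t‖ ≤ c := by
  simpa [hc.le] using norm_deriv_le_of_lipschitz (x₀ := t) hu.2

theorem phiVal_eq {u : ℝ → E3} {K : ℝ≥0} (hu : LipschitzWith K u)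
    (hmem : ∀ t ∈ Icc 0 T, (t, u t) ∈ Omega N S.r) :
    phiVal T S.V S.A u = (∫ t in (0:ℝ)..T, -S.V t (u t))
      + ∫ t in (0:ℝ)..T, inner ℝ (S.A t (u t)) (deriv u t) := by
  simp only [phiVal, dot_eq_inner]
  refine intervalIntegral.integral_add ?_ ?_
  · refine ContinuousOn.intervalIntegrable_of_Icc S.hT.le ?_
    exact (continuousOn_comp_path S.hV_C1.continuousOn hu.continuous hmem).neg
  · exact intervalIntegrable_inner S.hT.le
      (continuousOn_comp_path S.hA_C1.continuousOn hu.continuous hmem)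
      (stronglyMeasurable_deriv u) fun t _ => norm_deriv_le_of_lipschitz hu

theorem continuousOn_fderiv_V_apply {z : ℝ → E3} (hz : Continuous z) :
    ContinuousOn (fun p : ℝ × E3 => -fderiv ℝ (S.V p.1) p.2 (z p.1 - p.2)) (Omega N S.r) :=
  (S.continuousOn_fderiv_V.clm_apply
    ((hz.comp continuous_fst).sub continuous_snd).continuousOn).neg

theorem continuousOn_fderiv_A_apply {z : ℝ → E3} (hz : Continuous z) :
    ContinuousOn (fun p : ℝ × E3 => fderiv ℝ (S.A p.1) p.2 (z p.1 - p.2) - S.A p.1 p.2)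
      (Omega N S.r) :=
  (S.continuousOn_fderiv_A.clm_apply
    ((hz.comp continuous_fst).sub continuous_snd).continuousOn).sub S.hA_C1.continuousOn

theorem dPhi_sub_eq {u z : ℝ → E3} {K L : ℝ≥0} (hu : LipschitzWith K u) (hz : LipschitzWith L z)
    (hmem : ∀ t ∈ Icc 0 T, (t, u t) ∈ Omega N S.r) :
    dPhi T S.V S.A u (fun t => z t - u t)
      = (∫ t in (0:ℝ)..T, -fderiv ℝ (S.V t) (u t) (z t - u t))
        + (∫ t in (0:ℝ)..T, inner ℝ (S.A t (u t)) (deriv z t))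
        + ∫ t in (0:ℝ)..T,
          inner ℝ (fderiv ℝ (S.A t) (u t) (z t - u t) - S.A t (u t)) (deriv u t) := by
  have i1 : IntervalIntegrable (fun t => -fderiv ℝ (S.V t) (u t) (z t - u t)) volume 0 T :=
    ContinuousOn.intervalIntegrable_of_Icc S.hT.le
      (continuousOn_comp_path (continuousOn_fderiv_V_apply hz.continuous) hu.continuous hmem)
  have i2 := intervalIntegrable_inner S.hT.le
      (continuousOn_comp_path S.hA_C1.continuousOn hu.continuous hmem)
      (stronglyMeasurable_deriv z) fun t _ => norm_deriv_le_of_lipschitz hz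
  have i3 := intervalIntegrable_inner S.hT.le
      (continuousOn_comp_path (continuousOn_fderiv_A_apply hz.continuous) hu.continuous hmem)
      (stronglyMeasurable_deriv u) fun t _ => norm_deriv_le_of_lipschitz hu
  rw [← intervalIntegral.integral_add i1 i2, ← intervalIntegral.integral_add (i1.add i2) i3]
  refine intervalIntegral.integral_congr_ae ?_
  filter_upwards [hu.ae_differentiableAt_real, hz.ae_differentiableAt_real] with t h1 h2 _
  have h3 : deriv (fun t => z t - u t) t = deriv z t - deriv u t :=
    (h2.hasDerivAt.sub h1.hasDerivAt).deriv
  rw [dot_gradient, dot_jacT, dot_eq_inner, h3, inner_sub_right, inner_sub_left]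
  ring

theorem tendsto_phiVal {u : ℕ → ℝ → E3} {u₀ : ℝ → E3} {K : ℝ≥0}
    (hu : ∀ n, LipschitzWith K (u n)) (hu₀ : LipschitzWith K u₀)
    (hmem : ∀ n, ∀ t ∈ Icc 0 T, (t, u n t) ∈ Omega N S.r)
    (hmem₀ : ∀ t ∈ Icc 0 T, (t, u₀ t) ∈ Omega N S.r)
    (hlim : TendstoUniformlyOn u u₀ atTop (Icc 0 T)) :
    Tendsto (fun n => phiVal T S.V S.A (u n)) atTop (𝓝 (phiVal T S.V S.A u₀)) := by
  rw [phiVal_eq hu₀ hmem₀]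
  simp_rw [fun n => phiVal_eq (hu n) (hmem n)]
  have hVc := S.hV_C1.continuousOn.neg
  have hAc := S.hA_C1.continuousOn
  exact (tendsto_integral_of_tendstoUniformlyOn S.hT.le
      (fun n => continuousOn_comp_path hVc (hu n).continuous (hmem n))
      (continuousOn_comp_path hVc hu₀.continuous hmem₀)
      (tendstoUniformlyOn_comp_path S.isOpen_Omega hVc hu₀.continuous hmem₀ hlim)).add
    (tendsto_integral_inner_deriv S.hT.le hu hu₀ hlim
      (fun n => continuousOn_comp_path hAc (hu n).continuous (hmem n))
      (continuousOn_comp_path hAc hu₀.continuous hmem₀)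
      (tendstoUniformlyOn_comp_path S.isOpen_Omega hAc hu₀.continuous hmem₀ hlim))

theorem tendsto_dPhi_sub {u : ℕ → ℝ → E3} {u₀ z : ℝ → E3} {K L : ℝ≥0}
    (hu : ∀ n, LipschitzWith K (u n)) (hu₀ : LipschitzWith K u₀) (hz : LipschitzWith L z)
    (hmem : ∀ n, ∀ t ∈ Icc 0 T, (t, u n t) ∈ Omega N S.r)
    (hmem₀ : ∀ t ∈ Icc 0 T, (t, u₀ t) ∈ Omega N S.r)
    (hlim : TendstoUniformlyOn u u₀ atTop (Icc 0 T)) :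
    Tendsto (fun n => dPhi T S.V S.A (u n) fun t => z t - u n t) atTop
      (𝓝 (dPhi T S.V S.A u₀ fun t => z t - u₀ t)) := by
  rw [dPhi_sub_eq hu₀ hz hmem₀]
  simp_rw [fun n => dPhi_sub_eq (hu n) hz (hmem n)]
  have hVc := continuousOn_fderiv_V_apply (S := S) hz.continuous
  have hAc := S.hA_C1.continuousOn
  have hDc := continuousOn_fderiv_A_apply (S := S) hz.continuous
  exact ((tendsto_integral_of_tendstoUniformlyOn S.hT.le
      (fun n => continuousOn_comp_path hVc (hu n).continuous (hmem n))
      (continuousOn_comp_path hVc hu₀.continuous hmem₀)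
      (tendstoUniformlyOn_comp_path S.isOpen_Omega hVc hu₀.continuous hmem₀ hlim)).add
    (tendsto_integral_inner_const S.hT.le
      (fun n => continuousOn_comp_path hAc (hu n).continuous (hmem n))
      (continuousOn_comp_path hAc hu₀.continuous hmem₀)
      (tendstoUniformlyOn_comp_path S.isOpen_Omega hAc hu₀.continuous hmem₀ hlim)
      (stronglyMeasurable_deriv z) fun t _ => norm_deriv_le_of_lipschitz hz)).add
    (tendsto_integral_inner_deriv S.hT.le hu hu₀ hlim
      (fun n => continuousOn_comp_path hDc (hu n).continuous (hmem n))
      (continuousOn_comp_path hDc hu₀.continuous hmem₀)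
      (tendstoUniformlyOn_comp_path S.isOpen_Omega hDc hu₀.continuous hmem₀ hlim))

theorem norm_sub_le_of_lipschitzWith {u : ℝ → E3} {K : ℝ≥0} (hu : LipschitzWith K u) {s t : ℝ}
    (hst : s ≤ t) : ‖u t - u s‖ ≤ K * (t - s) := by
  have := hu.dist_le_mul t s
  rwa [dist_eq_norm, Real.dist_eq, abs_of_nonneg (sub_nonneg.2 hst)] at this

theorem dPhi_const_sub_le {u : ℝ → E3} (hu : MemDpsi T c u) (hmem : MemLambda T S.r u) {η : ℝ}
    (hη : ∀ t ∈ Icc 0 T,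
      ‖gradient (S.V t) (u t) + deriv (fun s => S.A s (u t)) t‖ ≤ η
        ∧ ‖curl (S.A t) (u t)‖ ≤ η) :
    dPhi T S.V S.A u (fun t => u 0 - u t) ≤ η * (c * T) * (1 + 6 * c) * T := by
  have hT := S.hT
  have hc := S.hc
  have hη0 : 0 ≤ η := (norm_nonneg _).trans (hη 0 ⟨le_rfl, hT.le⟩).2
  rw [dPhi_sub_eq hu.2 (LipschitzWith.const (u 0)) hmem.2]
  simp only [deriv_const, inner_zero_right, intervalIntegral.integral_zero, add_zero]
  have hHC : ContDiffOn ℝ 1 (fun p : ℝ × E3 => inner ℝ (S.A p.1 p.2) (u 0 - p.2))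
      (Omega N S.r) := S.hA_C1.inner ℝ (contDiff_const.sub contDiff_snd).contDiffOn
  obtain ⟨L, hL⟩ := exists_lipschitzOnWith_comp_path S.isOpen_Omega hHC hu.2 hmem.2
  rw [← uIcc_of_le hT.le] at hL
  have hac := hL.absolutelyContinuousOnInterval
  have hftc : ∫ t in (0:ℝ)..T, deriv (fun t => inner ℝ (S.A t (u t)) (u 0 - u t)) t = 0 := by
    have h := hac.integral_deriv_eq_sub
    have hT0 : u T = u 0 := by simpa using hu.1.1 0
    simpa [hT0] using h
  have i0 := hac.intervalIntegrable_deriv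
  have i1 : IntervalIntegrable (fun t => -fderiv ℝ (S.V t) (u t) (u 0 - u t)) volume 0 T :=
    ContinuousOn.intervalIntegrable_of_Icc hT.le
      (continuousOn_comp_path (continuousOn_fderiv_V_apply continuous_const)
        hu.2.continuous hmem.2)
  have i3 := intervalIntegrable_inner hT.le
      (continuousOn_comp_path (continuousOn_fderiv_A_apply (z := fun _ => u 0) continuous_const)
        hu.2.continuous hmem.2)
      (stronglyMeasurable_deriv u) fun t _ => hu.norm_deriv_le hc t
  have hsub := intervalIntegral.integral_sub (i1.add i3) i0
  have hadd := intervalIntegral.integral_add i1 i3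
  beta_reduce at hsub hadd hftc
  rw [hftc, sub_zero] at hsub
  rw [← hadd, ← hsub]
  refine (le_abs_self _).trans ?_
  have hb := intervalIntegral.norm_integral_le_of_norm_le_const_ae (a := 0) (b := T)
    (f := fun t => -fderiv ℝ (S.V t) (u t) (u 0 - u t)
      + inner ℝ (fderiv ℝ (S.A t) (u t) (u 0 - u t) - S.A t (u t)) (deriv u t)
      - deriv (fun t => inner ℝ (S.A t (u t)) (u 0 - u t)) t)
    (C := η * (c * T) * (1 + 6 * c)) ?_
  · rwa [sub_zero, abs_of_pos hT] at hb
  filter_upwards [hu.2.ae_differentiableAt_real] with t ht htI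
  rw [uIoc_of_le hT.le] at htI
  have htI' : t ∈ Icc 0 T := ⟨htI.1.le, htI.2⟩
  have hp : (t, u t) ∈ Omega N S.r := hmem.2 t htI'
  have hA' : HasDerivAt (fun t => S.A t (u t))
      (fderiv ℝ (fun p : ℝ × E3 => S.A p.1 p.2) (t, u t) (1, deriv u t)) t := by
    have hpath : HasDerivAt (fun s => (s, u s)) ((1 : ℝ), deriv u t) t :=
      (hasDerivAt_id t).prodMk ht.hasDerivAt
    exact (hasFDerivAt_of_contDiffOn S.isOpen_Omega S.hA_C1 hp).comp_hasDerivAt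
      (f := fun s => (s, u s)) t hpath
  have hsplit : fderiv ℝ (fun p : ℝ × E3 => S.A p.1 p.2) (t, u t) (1, deriv u t)
      = deriv (fun s => S.A s (u t)) t + fderiv ℝ (S.A t) (u t) (deriv u t) := by
    have h1 := deriv_fst_eq S.isOpen_Omega S.hA_C1 hp
    have h2 := fderiv_snd_eq S.isOpen_Omega S.hA_C1 hp
    simp only at h1 h2
    rw [h1, h2, ContinuousLinearMap.comp_apply, ← map_add]
    simp
  have hf' := (hA'.inner ℝ (ht.hasDerivAt.const_sub (u 0))).deriv
  rw [hf', hsplit]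
  have hgrad : fderiv ℝ (S.V t) (u t) (u 0 - u t)
      = inner ℝ (gradient (S.V t) (u t)) (u 0 - u t) := by
    rw [← dot_eq_inner, dot_gradient]
  have heq : -fderiv ℝ (S.V t) (u t) (u 0 - u t)
      + inner ℝ (fderiv ℝ (S.A t) (u t) (u 0 - u t) - S.A t (u t)) (deriv u t)
      - (inner ℝ (S.A t (u t)) (-deriv u t)
        + inner ℝ (deriv (fun s => S.A s (u t)) t + fderiv ℝ (S.A t) (u t) (deriv u t))
          (u 0 - u t))
      = -inner ℝ (gradient (S.V t) (u t) + deriv (fun s => S.A s (u t)) t) (u 0 - u t)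
        + (inner ℝ (fderiv ℝ (S.A t) (u t) (u 0 - u t)) (deriv u t)
          - inner ℝ (fderiv ℝ (S.A t) (u t) (deriv u t)) (u 0 - u t)) := by
    rw [hgrad, inner_sub_left, inner_add_left, inner_add_left, inner_neg_right]
    ring
  rw [heq]
  have hy : ‖u 0 - u t‖ ≤ c * T := by
    have := norm_sub_le_of_lipschitzWith hu.2 htI'.1
    rw [norm_sub_rev, Real.coe_toNNReal c hc.le, sub_zero] at this
    exact this.trans (by gcongr; exact htI.2)
  have hv := hu.norm_deriv_le hc t
  have hcurl := abs_inner_fderiv_sub_le (S.A t) (u t) (u 0 - u t) (deriv u t)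
  have hE := norm_inner_le_norm (𝕜 := ℝ)
    (gradient (S.V t) (u t) + deriv (fun s => S.A s (u t)) t) (u 0 - u t)
  refine (norm_add_le _ _).trans ?_
  rw [norm_neg]
  have b1 : ‖gradient (S.V t) (u t) + deriv (fun s => S.A s (u t)) t‖ * ‖u 0 - u t‖
      ≤ η * (c * T) :=
    mul_le_mul (hη t htI').1 hy (norm_nonneg _) hη0
  have b2 : 6 * ‖curl (S.A t) (u t)‖ * (‖u 0 - u t‖ * ‖deriv u t‖) ≤ 6 * η * ((c * T) * c) := by
    have := (hη t htI').2
    gcongr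
  rw [Real.norm_eq_abs (_ - _)]
  linarith

theorem psiVal_nonneg (hT : 0 ≤ T) (u : ℝ → E3) : 0 ≤ psiVal T c u :=
  intervalIntegral.integral_nonneg hT fun _ _ => kinetic_nonneg c _

theorem abs_inner_A_le {κ' : ℝ}
    (hAV1 : ∀ p ∈ Omega N S.r, ‖S.A p.1 p.2‖ ≤ -(κ' / c) * S.V p.1 p.2) {p : ℝ × E3}
    (hp : p ∈ Omega N S.r) {v : E3} (hv : ‖v‖ ≤ c) :
    |inner ℝ (S.A p.1 p.2) v| ≤ κ' * -S.V p.1 p.2 := by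
  have hc := S.hc
  have h1 := hAV1 p hp
  calc |inner ℝ (S.A p.1 p.2) v| ≤ ‖S.A p.1 p.2‖ * ‖v‖ := abs_real_inner_le_norm _ _
    _ ≤ (-(κ' / c) * S.V p.1 p.2) * c :=
        mul_le_mul h1 hv (norm_nonneg _) ((norm_nonneg _).trans h1)
    _ = κ' * -S.V p.1 p.2 := by field_simp

theorem phiVal_le_of_abs_V_le {κ' : ℝ} (hκ1 : κ' ≤ 1)
    (hVneg : ∀ p ∈ Omega N S.r, S.V p.1 p.2 < 0)
    (hAV1 : ∀ p ∈ Omega N S.r, ‖S.A p.1 p.2‖ ≤ -(κ' / c) * S.V p.1 p.2)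
    {u : ℝ → E3} (hu : MemDpsi T c u) (hmem : MemLambda T S.r u) {η : ℝ}
    (hη : ∀ t ∈ Icc 0 T, |S.V t (u t)| ≤ η) : phiVal T S.V S.A u ≤ 2 * η * T := by
  have hT := S.hT
  refine (le_abs_self _).trans ?_
  have hb := intervalIntegral.norm_integral_le_of_norm_le_const (a := 0) (b := T)
    (f := fun t => -(S.V t (u t)) + dot (S.A t (u t)) (deriv u t)) (C := 2 * η) ?_
  · rwa [sub_zero, abs_of_pos hT] at hb
  intro t ht
  rw [uIoc_of_le hT.le] at ht
  have ht' : t ∈ Icc 0 T := ⟨ht.1.le, ht.2⟩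
  have h1 := abs_inner_A_le hAV1 (hmem.2 t ht') (hu.norm_deriv_le S.hc t)
  have h2 := hVneg _ (hmem.2 t ht')
  have h3 := hη t ht'
  simp only at h1 h2
  rw [abs_of_neg h2] at h3
  rw [dot_eq_inner, Real.norm_eq_abs]
  refine (abs_add_le _ _).trans ?_
  rw [abs_of_pos (neg_pos.2 h2)]
  nlinarith

theorem mul_integral_neg_V_le_phiVal {κ' : ℝ}
    (hAV1 : ∀ p ∈ Omega N S.r, ‖S.A p.1 p.2‖ ≤ -(κ' / c) * S.V p.1 p.2)
    {u : ℝ → E3} (hu : MemDpsi T c u) (hmem : MemLambda T S.r u) :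
    (1 - κ') * ∫ t in (0:ℝ)..T, -S.V t (u t) ≤ phiVal T S.V S.A u := by
  have hT := S.hT
  have iV : IntervalIntegrable (fun t => -S.V t (u t)) volume 0 T :=
    ContinuousOn.intervalIntegrable_of_Icc hT.le
      (continuousOn_comp_path S.hV_C1.continuousOn hu.2.continuous hmem.2).neg
  have iA := intervalIntegrable_inner hT.le
      (continuousOn_comp_path S.hA_C1.continuousOn hu.2.continuous hmem.2)
      (stronglyMeasurable_deriv u) fun t _ => hu.norm_deriv_le S.hc t
  rw [phiVal_eq hu.2 hmem.2, ← intervalIntegral.integral_const_mul,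
    ← intervalIntegral.integral_add iV iA]
  refine intervalIntegral.integral_mono_on hT.le (iV.const_mul _) (iV.add iA) fun t ht => ?_
  have h1 := abs_inner_A_le hAV1 (hmem.2 t ht) (hu.norm_deriv_le S.hc t)
  have h2 := neg_abs_le (inner ℝ (S.A t (u t)) (deriv u t))
  simp only at h1
  linarith

theorem psiVal_const (x : E3) : psiVal T c (fun _ => x) = 0 := by
  simp [psiVal]

theorem memDpsi_const (x : E3) : MemDpsi T c (fun _ => x) :=
  ⟨⟨fun _ => rfl, 0, LipschitzWith.const x⟩, (LipschitzWith.const x).weaken zero_le⟩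

theorem exists_eventually_norm_le (hV : CondV S) (hAV1 : CondAV1 S) (hAV2 : CondAV2 S)
    {c₀ : ℝ} (hc₀ : 0 < c₀) {u : ℕ → ℝ → E3} (hu : ∀ n, MemDpsi T c (u n))
    (hmem : ∀ n, MemLambda T S.r (u n))
    (hI : Tendsto (fun n => psiVal T c (u n) + phiVal T S.V S.A (u n)) atTop (𝓝 c₀))
    {ε : ℕ → ℝ} (hε0 : ∀ n, 0 < ε n) (hε : Tendsto ε atTop (𝓝 0))
    (hPS : ∀ n z, MemDpsi T c z → psiVal T c (u n)
      ≤ dPhi T S.V S.A (u n) (fun t => z t - u n t) + ε n * Xdist T z (u n) + psiVal T c z) :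
    ∃ R, ∀ᶠ n in atTop, ‖u n 0‖ ≤ R := by
  have hT := S.hT
  have hc := S.hc
  obtain ⟨κ', -, hκ1, hA⟩ := hAV1
  have hB : 0 < c * T * (1 + 6 * c) * T + 2 * T := by positivity
  set B := c * T * (1 + 6 * c) * T + 2 * T with hBdef
  obtain ⟨R, hR⟩ := hAV2 (c₀ / 4 / B) (by positivity)
  refine ⟨R + c * T, ?_⟩
  have hε' : Tendsto (fun n => ε n * (c * T + c)) atTop (𝓝 0) := by
    simpa using hε.mul_const (c * T + c)
  filter_upwards [hI.eventually (lt_mem_nhds (half_lt_self hc₀)),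
    hε'.eventually (gt_mem_nhds (show (0:ℝ) < c₀ / 4 by positivity))] with n h1 h2
  by_contra! hn
  have hfar : ∀ t ∈ Icc 0 T, R < ‖u n t‖ := fun t ht => by
    have h3 := norm_sub_le_of_lipschitzWith (hu n).2 ht.1
    rw [Real.coe_toNNReal c hc.le, sub_zero, norm_sub_rev] at h3
    have h4 := norm_le_insert' (u n 0) (u n t)
    have h5 : c * t ≤ c * T := by gcongr; exact ht.2
    linarith
  have hsmall := fun t ht => hR (t, u n t) ((hmem n).2 t ht) (hfar t ht)
  have hphi : phiVal T S.V S.A (u n) ≤ 2 * (c₀ / 4 / B) * T := by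
    refine phiVal_le_of_abs_V_le hκ1.le hV.1 hA (hu n) (hmem n) fun t ht => ?_
    have := hsmall t ht
    simp only at this
    linarith [norm_nonneg (gradient (S.V t) (u n t) + deriv (fun s => S.A s (u n t)) t),
      norm_nonneg (curl (S.A t) (u n t))]
  have hdphi := dPhi_const_sub_le (hu n) (hmem n) (η := c₀ / 4 / B) fun t ht => by
    have := hsmall t ht
    simp only at this
    constructor <;>
    linarith [norm_nonneg (gradient (S.V t) (u n t) + deriv (fun s => S.A s (u n t)) t),
      norm_nonneg (curl (S.A t) (u n t)), abs_nonneg (S.V t (u n t))]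
  have hdist : Xdist T (fun _ => u n 0) (u n) ≤ c * T + c := by
    have hl : LipschitzWith (Real.toNNReal c) fun t => u n 0 - u n t := by
      simpa using (LipschitzWith.const (u n 0)).sub (hu n).2
    have := Xdist_le hT.le hl
    simpa [hc.le] using this
  have hps := hPS n (fun _ => u n 0) (memDpsi_const _)
  rw [psiVal_const] at hps
  have hεd : ε n * Xdist T (fun _ => u n 0) (u n) ≤ ε n * (c * T + c) := by
    have := (hε0 n).le
    gcongr
  have hcB : c₀ / 4 / B * (c * T) * (1 + 6 * c) * T + 2 * (c₀ / 4 / B) * T = c₀ / 4 := by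
    have : c₀ / 4 / B * (c * T) * (1 + 6 * c) * T + 2 * (c₀ / 4 / B) * T = c₀ / 4 / B * B := by
      rw [hBdef]; ring
    rw [this, div_mul_cancel₀ _ hB.ne']
  linarith

theorem exists_subseq_tendsto_of_lipschitzWith (hT : 0 < T) {K : ℝ≥0} {R : ℝ} {u : ℕ → ℝ → E3}
    (hper : ∀ n, Periodic (u n) T) (hu : ∀ n, LipschitzWith K (u n)) (hR : ∀ n, ‖u n 0‖ ≤ R) :
    ∃ (u₀ : ℝ → E3) (θ : ℕ → ℕ), StrictMono θ ∧ Periodic u₀ T ∧ LipschitzWith K u₀ ∧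
      TendstoUniformly (fun k => u (θ k)) u₀ atTop := by
  let f : ℕ → BoundedContinuousFunction (Icc (0 : ℝ) T) E3 := fun n =>
    .mkOfCompact ⟨fun t => u n t, (hu n).continuous.comp continuous_subtype_val⟩
  have hcpt : IsCompact (closure (range f)) := by
    refine BoundedContinuousFunction.arzela_ascoli (Metric.closedBall 0 (R + K * T))
      (isCompact_closedBall _ _) _ ?_ ?_
    · rintro _ t ⟨n, rfl⟩
      rw [mem_closedBall_zero_iff]
      have h1 := norm_sub_le_of_lipschitzWith (hu n) t.2.1
      have h2 := norm_le_insert' (u n t) (u n 0)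
      have h3 : (K : ℝ) * (t - 0) ≤ K * T := by
        gcongr
        simpa using t.2.2
      change ‖u n t‖ ≤ _
      linarith [hR n]
    · refine (LipschitzWith.uniformEquicontinuous _ K ?_).equicontinuous
      rintro ⟨_, n, rfl⟩
      exact LipschitzWith.of_dist_le_mul fun s t => (hu n).dist_le_mul s t
  obtain ⟨a, -, θ, hθ, hlim⟩ := hcpt.tendsto_subseq fun n => subset_closure (mem_range_self n)
  rw [BoundedContinuousFunction.tendsto_iff_tendstoUniformly] at hlim
  have hmod : ∀ t, toIcoMod hT 0 t ∈ Icc 0 T := fun t =>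
    Ico_subset_Icc_self (toIcoMod_mem_Ico' hT t)
  have hunif : TendstoUniformly (fun k => u (θ k)) (fun t => a ⟨toIcoMod hT 0 t, hmod t⟩)
      atTop := by
    refine fun v hv => (hlim v hv).mono fun k hk t => ?_
    have h : u (θ k) (toIcoMod hT 0 t) = u (θ k) t := by
      rw [← self_sub_toIcoDiv_zsmul, (hper _).sub_zsmul_eq]
    simp only [← h]
    exact hk ⟨toIcoMod hT 0 t, hmod t⟩
  refine ⟨_, θ, hθ, fun t => ?_, ?_, hunif⟩
  · simp only [toIcoMod_add_right]
  · refine LipschitzWith.of_dist_le_mul fun s t => ?_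
    exact le_of_tendsto' ((hunif.tendsto_at s).dist (hunif.tendsto_at t)) fun k =>
      (hu (θ k)).dist_le_mul s t

theorem integral_const_div_add_mul {κ b η a t₀ : ℝ} (hb : 0 < b) (hη : 0 < η) (ha : 0 ≤ a) :
    ∫ t in t₀..t₀ + a, κ / (η + b * (t - t₀))
      = κ / b * (Real.log (η + b * a) - Real.log η) := by
  have hpos : ∀ t ∈ uIcc t₀ (t₀ + a), 0 < η + b * (t - t₀) := fun t ht => by
    rw [uIcc_of_le (by linarith)] at ht
    have := mul_nonneg hb.le (sub_nonneg.2 ht.1)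
    linarith
  have hint : IntervalIntegrable (fun t => κ / (η + b * (t - t₀))) volume t₀ (t₀ + a) :=
    (continuousOn_const.div (by fun_prop) fun t ht => (hpos t ht).ne').intervalIntegrable
  have hderiv : ∀ t ∈ uIcc t₀ (t₀ + a), HasDerivAt
      (fun t => κ / b * Real.log (η + b * (t - t₀))) (κ / (η + b * (t - t₀))) t := fun t ht => by
    have hne := (hpos t ht).ne'
    have h := ((((hasDerivAt_id t).sub_const t₀).const_mul b).const_add η).log hne
    refine (h.const_mul (κ / b)).congr_deriv ?_
    simp only [id_eq]
    field_simp
  rw [intervalIntegral.integral_eq_sub_of_hasDerivAt hderiv hint]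
  simp only [add_sub_cancel_left, sub_self, mul_zero, add_zero]
  ring

theorem Setting.lipschitzWith_r (S : Setting T c N) (i : Fin N) :
    LipschitzWith (Real.toNNReal c) (S.r i) := by
  obtain ⟨b, hb, h⟩ := S.hr_speed i
  refine lipschitzWith_of_nnnorm_deriv_le ((S.hr_C1 i).differentiable one_ne_zero) fun t => ?_
  rw [← NNReal.coe_le_coe, coe_nnnorm, Real.coe_toNNReal c S.hc.le]
  exact (h t).trans hb.le

theorem ne_r_of_tendsto_of_integral_le (hV : CondV S) {u : ℕ → ℝ → E3}
    (hu : ∀ n, MemDpsi T c (u n)) (hmem : ∀ n, MemLambda T S.r (u n)) {M : ℝ}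
    (hM : ∀ n, ∫ t in (0:ℝ)..T, -S.V t (u n t) ≤ M) {t₀ : ℝ} {x : E3}
    (hlim : Tendsto (fun n => u n t₀) atTop (𝓝 x)) (i : Fin N) : x ≠ S.r i t₀ := by
  rintro rfl
  have hT := S.hT
  have hc := S.hc
  obtain ⟨hneg, κ, hκ, δ, hδ, hblow⟩ := hV
  set a := min T (δ / (4 * c)) with ha_def
  have ha : 0 < a := lt_min hT (by positivity)
  have haT : a ≤ T := min_le_left _ _
  have haδ : 2 * c * a ≤ δ / 2 := by
    calc 2 * c * a ≤ 2 * c * (δ / (4 * c)) := by gcongr; exact min_le_right _ _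
      _ = δ / 2 := by field_simp; norm_num
  set η := min (δ / 4) (2 * c * a * Real.exp (-(2 * c * M / κ + 1))) with hη_def
  have hη : 0 < η := lt_min (by positivity) (by positivity)
  have hηδ : η ≤ δ / 4 := min_le_left _ _
  have hηlog : Real.log η ≤ Real.log (2 * c * a) - (2 * c * M / κ + 1) := by
    have := Real.log_le_log hη (min_le_right _ _)
    rwa [Real.log_mul (by positivity) (Real.exp_ne_zero _), Real.log_exp] at this
  obtain ⟨n, hn⟩ := (hlim.eventually (Metric.ball_mem_nhds _ hη)).exists
  rw [dist_eq_norm] at hn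
  have hΩ : ∀ t, (t, u n t) ∈ Omega N S.r := (hmem n).mem_Omega
  have hdist : ∀ t, t₀ ≤ t → ‖u n t - S.r i t‖ ≤ η + 2 * c * (t - t₀) := fun t ht => by
    have h1 := norm_sub_le_of_lipschitzWith (hu n).2 ht
    have h2 := norm_sub_le_of_lipschitzWith (S.lipschitzWith_r i) ht
    rw [Real.coe_toNNReal c hc.le] at h1 h2
    have h3 : u n t - S.r i t
        = (u n t - u n t₀) + (u n t₀ - S.r i t₀) - (S.r i t - S.r i t₀) := by abel
    rw [h3]
    have h4 := norm_sub_le ((u n t - u n t₀) + (u n t₀ - S.r i t₀)) (S.r i t - S.r i t₀)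
    have h5 := norm_add_le (u n t - u n t₀) (u n t₀ - S.r i t₀)
    linarith
  have hcont : ∀ s t, s ≤ t → IntervalIntegrable (fun t => -S.V t (u n t)) volume s t :=
    fun s t hst => ContinuousOn.intervalIntegrable_of_Icc hst
      (S.hV_C1.continuousOn.comp_continuous (continuous_id.prodMk (hu n).2.continuous)
        hΩ).neg.continuousOn
  have hper : Periodic (fun t => -S.V t (u n t)) T := fun t => by
    simp only [S.hV_per, (hu n).1.1 t]
  have h1 : ∫ t in t₀..t₀ + a, κ / (η + 2 * c * (t - t₀))
      ≤ ∫ t in t₀..t₀ + a, -S.V t (u n t) := by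
    refine intervalIntegral.integral_mono_on (by linarith) ?_ (hcont _ _ (by linarith))
      fun t ht => ?_
    · refine ContinuousOn.intervalIntegrable_of_Icc (by linarith) fun t ht =>
        (ContinuousWithinAt.div continuousWithinAt_const (by fun_prop) ?_)
      have := mul_nonneg hc.le (sub_nonneg.2 ht.1)
      linarith
    · have hd := hdist t ht.1
      have hle : 2 * c * (t - t₀) ≤ 2 * c * a := by
        gcongr
        linarith [ht.2]
      have hpos : 0 < ‖u n t - S.r i t‖ := norm_pos_iff.2 (sub_ne_zero.2 (hΩ t i))
      have hb := hblow i (t, u n t) (hΩ t) (by simp only; linarith)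
      simp only [neg_div] at hb
      have := div_le_div_of_nonneg_left hκ.le hpos hd
      linarith
  have h2 : ∫ t in t₀..t₀ + a, -S.V t (u n t) ≤ ∫ t in t₀..t₀ + T, -S.V t (u n t) :=
    intervalIntegral.integral_mono_interval le_rfl (by linarith) (by linarith)
      (Eventually.of_forall fun t => (neg_pos.2 (hneg _ (hΩ t))).le) (hcont _ _ (by linarith))
  rw [integral_const_div_add_mul (by positivity) hη ha.le] at h1
  rw [hper.intervalIntegral_add_eq t₀ 0, zero_add] at h2
  have h3 : Real.log (2 * c * a) ≤ Real.log (η + 2 * c * a) :=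
    Real.log_le_log (by positivity) (by linarith)
  have h4 : κ / (2 * c) * (2 * c * M / κ + 1)
      ≤ κ / (2 * c) * (Real.log (η + 2 * c * a) - Real.log η) := by
    gcongr
    linarith
  have h5 : κ / (2 * c) * (2 * c * M / κ + 1) = M + κ / (2 * c) := by field_simp
  have h6 : 0 < κ / (2 * c) := by positivity
  linarith [hM n]

theorem psiVal_le_of_tendstoUniformlyOn {u : ℕ → ℝ → E3} {x₀ : ℝ → E3}
    (hu : ∀ n, MemDpsi T c (u n)) (hmem : ∀ n, MemLambda T S.r (u n)) (hx₀ : MemDpsi T c x₀)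
    (hmem₀ : MemLambda T S.r x₀) (hlim : TendstoUniformlyOn u x₀ atTop (Icc 0 T))
    {ε : ℕ → ℝ} (hε0 : ∀ n, 0 < ε n) (hε : Tendsto ε atTop (𝓝 0))
    (hPS : ∀ n z, MemDpsi T c z → psiVal T c (u n)
      ≤ dPhi T S.V S.A (u n) (fun t => z t - u n t) + ε n * Xdist T z (u n) + psiVal T c z)
    {z : ℝ → E3} (hz : MemDpsi T c z) :
    ∃ b : ℕ → ℝ, (∀ n, psiVal T c (u n) ≤ b n) ∧
      Tendsto b atTop (𝓝 (dPhi T S.V S.A x₀ (fun t => z t - x₀ t) + psiVal T c z)) := by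
  have hT := S.hT
  have hd := tendsto_dPhi_sub (fun n => (hu n).2) hx₀.2 hz.2 (fun n => (hmem n).2) hmem₀.2 hlim
  have h0 : Tendsto (fun n => u n 0) atTop (𝓝 (x₀ 0)) := hlim.tendsto_at ⟨le_rfl, hT.le⟩
  set K := Real.toNNReal c + Real.toNNReal c
  have hb : Tendsto (fun n => ε n * (‖z 0 - u n 0‖ + K * T + K)) atTop (𝓝 0) := by
    simpa using hε.mul (((h0.const_sub (z 0)).norm.add_const (K * T)).add_const (K : ℝ))
  refine ⟨fun n => dPhi T S.V S.A (u n) (fun t => z t - u n t)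
    + ε n * (‖z 0 - u n 0‖ + K * T + K) + psiVal T c z, fun n => (hPS n z hz).trans ?_, ?_⟩
  · have h1 := Xdist_le hT.le (hz.2.sub (hu n).2)
    have h2 := mul_le_mul_of_nonneg_left h1 (hε0 n).le
    linarith
  · simpa using (hd.add hb).add_const (psiVal T c z)

theorem exists_critical_of_palais_smale (hV : CondV S) (hAV1 : CondAV1 S) (hAV2 : CondAV2 S)
    {c₀ : ℝ} (hc₀ : 0 < c₀) {u : ℕ → ℝ → E3} (hu : ∀ n, MemDpsi T c (u n))
    (hmem : ∀ n, MemLambda T S.r (u n))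
    (hI : Tendsto (fun n => psiVal T c (u n) + phiVal T S.V S.A (u n)) atTop (𝓝 c₀))
    {ε : ℕ → ℝ} (hε0 : ∀ n, 0 < ε n) (hε : Tendsto ε atTop (𝓝 0))
    (hPS : ∀ n z, MemDpsi T c z → psiVal T c (u n)
      ≤ dPhi T S.V S.A (u n) (fun t => z t - u n t) + ε n * Xdist T z (u n) + psiVal T c z) :
    ∃ (x₀ : ℝ → E3) (φ : ℕ → ℕ), StrictMono φ ∧ MemDpsi T c x₀ ∧ MemLambda T S.r x₀ ∧
      (∀ z, MemDpsi T c z →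
        psiVal T c x₀ ≤ dPhi T S.V S.A x₀ (fun t => z t - x₀ t) + psiVal T c z) ∧
      psiVal T c x₀ + phiVal T S.V S.A x₀ = c₀ ∧
      TendstoUniformlyOn (fun k => u (φ k)) x₀ atTop (Icc 0 T) := by
  have hT := S.hT
  obtain ⟨R, hR⟩ := exists_eventually_norm_le hV hAV1 hAV2 hc₀ hu hmem hI hε0 hε hPS
  obtain ⟨m, hm⟩ := eventually_atTop.1 (hR.and (hI.eventually (gt_mem_nhds (lt_add_one c₀))))
  obtain ⟨x₀, θ, hθ, hper, hlip, hlim⟩ := exists_subseq_tendsto_of_lipschitzWith hT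
    (u := fun n => u (n + m)) (fun n => (hu _).1.1) (fun n => (hu _).2)
    fun n => (hm (n + m) (Nat.le_add_left m n)).1
  have hφ : StrictMono fun k => θ k + m := fun i j hij => Nat.add_lt_add_right (hθ hij) m
  have hX : MemX T x₀ := ⟨hper, _, hlip⟩
  have hx₀ : MemDpsi T c x₀ := ⟨hX, hlip⟩
  have hmem₀ : MemLambda T S.r x₀ := by
    obtain ⟨κ', -, hκ1, hA⟩ := hAV1
    refine ⟨hX, fun t _ i => ne_r_of_tendsto_of_integral_le hV (fun k => hu (θ k + m))
      (fun k => hmem (θ k + m)) (M := (c₀ + 1) / (1 - κ')) (fun k => ?_) (hlim.tendsto_at t) i⟩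
    rw [le_div_iff₀' (sub_pos.2 hκ1)]
    have h1 := mul_integral_neg_V_le_phiVal hA (hu (θ k + m)) (hmem (θ k + m))
    have h2 := psiVal_nonneg (c := c) hT.le (u (θ k + m))
    linarith [(hm (θ k + m) (Nat.le_add_left m _)).2]
  have hlimOn := hlim.tendstoUniformlyOn (s := Icc 0 T)
  have hbound := fun {z} => psiVal_le_of_tendstoUniformlyOn (fun k => hu (θ k + m))
    (fun k => hmem (θ k + m)) hx₀ hmem₀ hlimOn (fun k => hε0 (θ k + m))
    (hε.comp hφ.tendsto_atTop) (fun k => hPS (θ k + m)) (z := z)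
  have hpsi : Tendsto (fun k => psiVal T c (u (θ k + m))) atTop (𝓝 (psiVal T c x₀)) := by
    obtain ⟨b, hb, hbt⟩ := hbound hx₀
    have h0 : dPhi T S.V S.A x₀ (fun t => x₀ t - x₀ t) = 0 := by
      simp [dPhi, dot_eq_inner]
    rw [h0, zero_add] at hbt
    refine tendsto_order.2 ⟨fun a ha => ?_, fun a ha => ?_⟩
    · exact eventually_lt_psiVal S.hc hT.le (fun k => (hu (θ k + m)).1.1)
        (fun k => (hu (θ k + m)).2) hlip hlim.tendsto_at ha
    · filter_upwards [hbt.eventually (gt_mem_nhds ha)] with k hk using (hb k).trans_lt hk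
  have hphi := tendsto_phiVal (fun k => (hu (θ k + m)).2) hlip (fun k => (hmem (θ k + m)).2)
    hmem₀.2 hlimOn
  refine ⟨x₀, fun k => θ k + m, hφ, hx₀, hmem₀, fun z hz => ?_,
    tendsto_nhds_unique (hpsi.add hphi) (hI.comp hφ.tendsto_atTop), hlimOn⟩
  obtain ⟨b, hb, hbt⟩ := hbound hz
  exact le_of_tendsto_of_tendsto' hpsi hbt hb

theorem psiE_of_memDpsi {u : ℝ → E3} (hu : MemDpsi T c u) : psiE T c u = psiVal T c u :=
  if_pos hu

theorem psiE_of_not_memDpsi {u : ℝ → E3} (hu : ¬MemDpsi T c u) : psiE T c u = ⊤ :=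
  if_neg hu

theorem IE_of_mem {r : Fin N → ℝ → E3} {V : ℝ → E3 → ℝ} {A : ℝ → E3 → E3} {u : ℝ → E3}
    (hu : MemDpsi T c u) (hmem : MemLambda T r u) :
    IE T c r V A u = ((psiVal T c u + phiVal T V A u : ℝ) : EReal) := by
  rw [IE, psiE_of_memDpsi hu, phiE, if_pos hmem, EReal.coe_add]

theorem memDpsi_and_memLambda_of_IE_lt_top {r : Fin N → ℝ → E3} {V : ℝ → E3 → ℝ}
    {A : ℝ → E3 → E3} {u : ℝ → E3} (h : IE T c r V A u < ⊤) :
    MemDpsi T c u ∧ MemLambda T r u := by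
  by_contra hn
  refine h.ne ?_
  unfold IE psiE phiE
  split_ifs with h1 h2 h2
  · exact absurd ⟨h1, h2⟩ hn
  · exact EReal.coe_add_top _
  · exact EReal.top_add_coe _
  · exact EReal.top_add_top

end Action

end LFE

/-- **Lemma (weak Palais–Smale condition).** Under (V), (AV1), (AV2), the functional
`I = ψ + Φ` satisfies the weak Palais–Smale condition at every level `c₀ > 0` with respect
to `Y = L^∞(0,T;ℝ³)`: every Palais–Smale sequence at level `c₀` has a subsequence converging
uniformly on `[0,T]` to a critical point of `I` at level `c₀`. -/
theorem weak_palais_smale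
    {T c : ℝ} {N : ℕ} (S : LFE.Setting T c N)
    (hV : LFE.CondV S) (hAV1 : LFE.CondAV1 S) (hAV2 : LFE.CondAV2 S)
    (c₀ : ℝ) (hc₀ : 0 < c₀)
    (x : ℕ → ℝ → LFE.E3) (hxX : ∀ n, LFE.MemX T (x n))
    (hI : Filter.Tendsto (fun n => LFE.IE T c S.r S.V S.A (x n)) Filter.atTop
      (nhds (c₀ : EReal)))
    (ε : ℕ → ℝ) (hε0 : ∀ n, 0 < ε n) (hε : Filter.Tendsto ε Filter.atTop (nhds 0))
    (hPS : ∀ n, ∀ z : ℝ → LFE.E3, LFE.MemX T z →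
      LFE.psiE T c (x n) ≤
        ((LFE.dPhi T S.V S.A (x n) (fun t => z t - x n t)
          + ε n * LFE.Xdist T z (x n) : ℝ) : EReal) + LFE.psiE T c z) :
    ∃ (x₀ : ℝ → LFE.E3) (φ : ℕ → ℕ), StrictMono φ ∧
      LFE.MemDpsi T c x₀ ∧ LFE.MemLambda T S.r x₀ ∧
      (∀ z : ℝ → LFE.E3, LFE.MemX T z →
        LFE.psiE T c x₀ ≤
          ((LFE.dPhi T S.V S.A x₀ (fun t => z t - x₀ t) : ℝ) : EReal) + LFE.psiE T c z) ∧
      LFE.IE T c S.r S.V S.A x₀ = (c₀ : EReal) ∧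
      TendstoUniformlyOn (fun k t => x (φ k) t) x₀ Filter.atTop (Set.Icc 0 T) := by
  obtain ⟨m, hm⟩ := eventually_atTop.1 (hI.eventually (gt_mem_nhds (EReal.coe_lt_top c₀)))
  have hmem := fun n =>
    LFE.memDpsi_and_memLambda_of_IE_lt_top (hm (n + m) (Nat.le_add_left m n))
  have hIr : Tendsto (fun n => LFE.psiVal T c (x (n + m)) + LFE.phiVal T S.V S.A (x (n + m)))
      atTop (𝓝 c₀) := by
    rw [← EReal.tendsto_coe]
    exact (hI.comp (tendsto_add_atTop_nat m)).congr fun n =>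
      LFE.IE_of_mem (hmem n).1 (hmem n).2
  obtain ⟨x₀, φ, hφ, hx₀, hΛ, hcrit, hval, hlim⟩ :=
    LFE.exists_critical_of_palais_smale hV hAV1 hAV2 hc₀ (fun n => (hmem n).1)
      (fun n => (hmem n).2) hIr (fun n => hε0 (n + m)) (hε.comp (tendsto_add_atTop_nat m))
      fun n z hz => by
        have h := hPS (n + m) z hz.1
        rw [LFE.psiE_of_memDpsi (hmem n).1, LFE.psiE_of_memDpsi hz, ← EReal.coe_add,
          EReal.coe_le_coe_iff] at h
        exact h
  refine ⟨x₀, fun k => φ k + m, fun i j hij => Nat.add_lt_add_right (hφ hij) m, hx₀, hΛ,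
    fun z _ => ?_, ?_, hlim⟩
  · by_cases hz : LFE.MemDpsi T c z
    · rw [LFE.psiE_of_memDpsi hx₀, LFE.psiE_of_memDpsi hz, ← EReal.coe_add,
        EReal.coe_le_coe_iff]
      exact hcrit z hz
    · rw [LFE.psiE_of_not_memDpsi hz, EReal.coe_add_top]
      exact le_top
  · rw [LFE.IE_of_mem hx₀ hΛ, hval]
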